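/- arXiv:math/0402248 — 2 statements merged into one kernel-verified Lean document; each statement's English description precedes it below -/
import Mathlib

section
/- Fix w, v ∈ H⁺ such that w, v, i are pairwise distinct. Let F(z) = α(w,z) and G(z) = α(z,v), which are smooth real-valued functions of z on H⁺ ∖ {w, v, i}. Writing z = x + iy, the function (∂F/∂x)(∂G/∂y) − (∂F/∂y)(∂G/∂x) is absolutely integrable on H⁺ with respect to Lebesgue measure, and ∫_{H⁺} ((∂F/∂x)(∂G/∂y) − (∂F/∂y)(∂G/∂x)) dx dy = 0; i.e. ∫_{H⁺} dα(w,z) ∧ dα(z,v) = 0. -/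
open MeasureTheory

/-- The Shoikhet angle function `α(p,q) = Arg(p−q) − Arg(p̄−q) − Arg(p−i) + Arg(p̄−i)`
for points of the upper half-plane. -/
noncomputable def shoikhetAngle (p q : ℂ) : ℝ :=
  (p - q).arg - ((starRingEnd ℂ) p - q).arg - (p - Complex.I).arg
    + ((starRingEnd ℂ) p - Complex.I).arg

namespace ShoikhetAngle

open Complex ComplexConjugate

/-- The argument of a differentiable function with values in the slit plane is differentiable. -/
lemma hasFDerivAt_arg {E : Type*} [NormedAddCommGroup E] [NormedSpace ℝ E] {f : E → ℂ}
    {f' : E →L[ℝ] ℂ} {z : E} (hf : HasFDerivAt f f' z) (hz : (f z).im ≠ 0) :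
    HasFDerivAt (fun z => (f z).arg) (imCLM.comp ((f z)⁻¹ • f')) z := by
  have h1 : HasFDerivAt log _ (f z) :=
    (hasDerivAt_log (Or.inr hz : f z ∈ slitPlane)).hasFDerivAt.restrictScalars ℝ
  have h2 := imCLM.hasFDerivAt.comp z (h1.comp z hf)
  have e : (fun z => (f z).arg) = (imCLM : ℂ → ℝ) ∘ log ∘ f := by
    funext x; simp [log_im]
  rw [e]
  refine h2.congr_fderiv ?_
  ext x
  simp [mul_comm]

/-- The Jacobian determinant of the pair `(Arg (z - a), Arg (z - b))`. -/
noncomputable def argJacobian (a b z : ℂ) : ℝ := ((z - a)⁻¹ * conj ((z - b)⁻¹)).im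

lemma abs_argJacobian_le_right {a b z : ℂ} (ha : z ≠ a) (hb : z ≠ b) :
    |argJacobian a b z| ≤ ‖a - b‖ * (‖z - a‖⁻¹ * (‖z - b‖⁻¹) ^ 2) := by
  have ha' := sub_ne_zero.2 ha
  have hb' := sub_ne_zero.2 hb
  have h : argJacobian a b z = ((a - b) * (z - a)⁻¹ * (z - b)⁻¹ * conj ((z - b)⁻¹)).im := by
    have e : (a - b) * (z - a)⁻¹ * (z - b)⁻¹ = (z - a)⁻¹ - (z - b)⁻¹ := by
      field_simp; ring
    rw [e, sub_mul, sub_im, mul_conj, ofReal_im, sub_zero, argJacobian]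
  rw [h]
  refine (abs_im_le_norm _).trans (le_of_eq ?_)
  simp only [norm_mul, norm_inv, RCLike.norm_conj]
  ring

lemma argJacobian_swap (a b z : ℂ) : argJacobian b a z = -argJacobian a b z := by
  simp only [argJacobian, mul_im, conj_re, conj_im]
  ring

/-- An integrable radial majorant. -/
lemma integrable_norm_inv_mul_one_add_sq_inv :
    Integrable (fun z : ℂ => ‖z‖⁻¹ * ((1 + ‖z‖) ^ 2)⁻¹) := by
  rw [integrable_fun_norm_addHaar (volume : Measure ℂ) (f := fun r => r⁻¹ * ((1 + r) ^ 2)⁻¹)]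
  have h : IntegrableOn (fun r : ℝ => (1 + r) ^ (-2 : ℝ)) (Set.Ioi 0) := by
    have := integrableOn_add_rpow_Ioi_of_lt (a := -2) (c := 0) (m := 1) (by norm_num) (by norm_num)
    simpa [add_comm] using this
  refine h.congr_fun (fun r hr => ?_) measurableSet_Ioi
  have hr : 0 < r := hr
  have : (1 + r) ^ (-2 : ℝ) = ((1 + r) ^ 2)⁻¹ := by
    rw [Real.rpow_neg (by positivity)]; norm_cast
  simp only [finrank_real_complex, this, smul_eq_mul]
  field_simp
  simp

lemma inv_mul_inv_sq_le {r s d : ℝ} (hr : 0 < r) (hrs : r ≤ s) (hd : 0 < d) (hds : d ≤ r + s) :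
    r⁻¹ * s⁻¹ ^ 2 ≤ (2 + 4 / d) ^ 2 * (r⁻¹ * ((1 + r) ^ 2)⁻¹) := by
  have hs : 0 < s := hr.trans_le hrs
  have h : 1 + r ≤ (2 + 4 / d) * s := by
    have : 1 ≤ 4 / d * s := by rw [div_mul_eq_mul_div, le_div_iff₀ hd]; linarith
    nlinarith
  have h2 : (1 + r) ^ 2 ≤ ((2 + 4 / d) * s) ^ 2 := by gcongr
  have h3 : s⁻¹ ^ 2 ≤ (2 + 4 / d) ^ 2 * ((1 + r) ^ 2)⁻¹ := by
    rw [inv_pow, ← div_eq_mul_inv, le_div_iff₀ (by positivity), inv_mul_le_iff₀ (by positivity)]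
    linarith [mul_pow (2 + 4 / d) s 2]
  calc r⁻¹ * s⁻¹ ^ 2 ≤ r⁻¹ * ((2 + 4 / d) ^ 2 * ((1 + r) ^ 2)⁻¹) := by gcongr
    _ = _ := by ring

lemma abs_argJacobian_le_of_norm_le {a b z : ℂ} (hab : a ≠ b) (ha : z ≠ a) (hb : z ≠ b)
    (h : ‖z - a‖ ≤ ‖z - b‖) :
    |argJacobian a b z| ≤
      ‖a - b‖ * (2 + 4 / ‖a - b‖) ^ 2 * (‖z - a‖⁻¹ * ((1 + ‖z - a‖) ^ 2)⁻¹) := by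
  refine (abs_argJacobian_le_right ha hb).trans ?_
  rw [mul_assoc]
  refine mul_le_mul_of_nonneg_left ?_ (norm_nonneg _)
  refine inv_mul_inv_sq_le (norm_pos_iff.2 (sub_ne_zero.2 ha)) h
    (norm_pos_iff.2 (sub_ne_zero.2 hab)) ?_
  rw [norm_sub_rev z a]
  exact norm_sub_le_norm_sub_add_norm_sub a z b

lemma integrable_argJacobian (a b : ℂ) : Integrable (argJacobian a b) := by
  rcases eq_or_ne a b with rfl | hab
  · have : argJacobian a a = fun _ => 0 := by
      funext z; rw [argJacobian, mul_conj, ofReal_im]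
    rw [this]; exact integrable_zero _ _ _
  set h : ℂ → ℝ := fun z => ‖z‖⁻¹ * ((1 + ‖z‖) ^ 2)⁻¹ with hh
  have hi : Integrable h := integrable_norm_inv_mul_one_add_sq_inv
  have hpos : ∀ z, 0 ≤ h z := fun z => by positivity
  have hint := ((hi.comp_sub_right a).add (hi.comp_sub_right b)).const_mul
    (‖a - b‖ * (2 + 4 / ‖a - b‖) ^ 2)
  refine hint.mono' ?_ ?_
  · refine Measurable.aestronglyMeasurable ?_
    unfold argJacobian
    fun_prop
  · have hne : ∀ c : ℂ, ∀ᵐ z : ℂ, z ≠ c := fun c => by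
      simp [ae_iff]
    filter_upwards [hne a, hne b] with z hza hzb
    rw [Real.norm_eq_abs]
    rcases le_total ‖z - a‖ ‖z - b‖ with hle | hle
    · refine (abs_argJacobian_le_of_norm_le hab hza hzb hle).trans ?_
      have := hpos (z - b)
      simp only [Pi.add_apply]
      gcongr
      exact le_add_of_nonneg_right this
    · rw [← abs_neg, ← argJacobian_swap]
      refine (abs_argJacobian_le_of_norm_le hab.symm hzb hza hle).trans ?_
      rw [norm_sub_rev b a]
      have := hpos (z - a)
      simp only [Pi.add_apply]
      gcongr
      exact le_add_of_nonneg_left this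

/-- The point reflection `z ↦ a + b - z` negates the integrand. -/
lemma integral_argJacobian (a b : ℂ) : ∫ z, argJacobian a b z = 0 := by
  have h : ∀ z, argJacobian a b (a + b - z) = -argJacobian a b z := fun z => by
    rw [← argJacobian_swap, argJacobian, argJacobian,
      show a + b - z - a = -(z - b) by ring, show a + b - z - b = -(z - a) by ring]
    simp only [inv_neg, map_neg, neg_mul_neg]
  have h2 := integral_sub_left_eq_self (argJacobian a b) (volume : Measure ℂ) (a + b)
  simp only [h, integral_neg] at h2
  linarith

/-- The Jacobian of `(α(w,·), α(·,v))`, extended to the whole plane. -/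
noncomputable def wedge (w v z : ℂ) : ℝ :=
  (((z - w)⁻¹ - (z - conj w)⁻¹) *
    conj ((z - v)⁻¹ + (z - conj v)⁻¹ - (z - I)⁻¹ - (z - conj I)⁻¹)).im

lemma wedge_eq (w v : ℂ) : wedge w v = fun z =>
    argJacobian w v z + argJacobian w (conj v) z - argJacobian w I z - argJacobian w (conj I) z
      - (argJacobian (conj w) v z + argJacobian (conj w) (conj v) z - argJacobian (conj w) I z
        - argJacobian (conj w) (conj I) z) := by
  funext z
  simp only [wedge, argJacobian, map_add, map_sub, sub_mul, mul_sub, mul_add, sub_im, add_im]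
  ring

lemma integrable_wedge (w v : ℂ) : Integrable (wedge w v) := by
  rw [wedge_eq]
  have := integrable_argJacobian
  exact ((((this _ _).add (this _ _)).sub (this _ _)).sub (this _ _)).sub
    ((((this _ _).add (this _ _)).sub (this _ _)).sub (this _ _))

lemma integral_wedge (w v : ℂ) : ∫ z, wedge w v z = 0 := by
  have h := integrable_argJacobian
  have h2 : ∀ a b c : ℂ, Integrable (fun z => argJacobian a b z + argJacobian a c z) :=
    fun a b c => (h _ _).add (h _ _)
  have h3 : ∀ a b c d : ℂ, Integrable (fun z => argJacobian a b z + argJacobian a c z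
      - argJacobian a d z) := fun a b c d => (h2 _ _ _).sub (h _ _)
  have h4 : ∀ a b c d e : ℂ, Integrable (fun z => argJacobian a b z + argJacobian a c z
      - argJacobian a d z - argJacobian a e z) := fun a b c d e => (h3 _ _ _ _).sub (h _ _)
  have h5 : ∀ a b c d e : ℂ, ∫ z, (argJacobian a b z + argJacobian a c z
      - argJacobian a d z - argJacobian a e z) = 0 := fun a b c d e => by
    rw [integral_sub (h3 _ _ _ _) (h _ _), integral_sub (h2 _ _ _) (h _ _),
      integral_add (h _ _) (h _ _)]
    simp only [integral_argJacobian]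
    ring
  rw [wedge_eq, integral_sub (h4 _ _ _ _ _) (h4 _ _ _ _ _), h5, h5, sub_zero]

lemma wedge_conj (w v z : ℂ) : wedge w v (conj z) = wedge w v z := by
  have e : ∀ a : ℂ, (conj z - a)⁻¹ = conj ((z - conj a)⁻¹) := fun a => by
    rw [map_inv₀, map_sub, conj_conj]
  simp only [wedge, e, conj_conj, map_add, map_sub, mul_im, conj_re, conj_im, add_re, add_im,
    sub_re, sub_im]
  ring

lemma volume_snd_eq (c : ℝ) : ∀ᵐ z : ℝ × ℝ, z.2 ≠ c := by
  have : {z : ℝ × ℝ | ¬ z.2 ≠ c} = Set.univ ×ˢ {c} := by ext; simp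
  rw [ae_iff, this, Measure.volume_eq_prod, Measure.prod_prod]
  simp

/-- A function on the plane that is even in `y` integrates to half its total over `y > 0`. -/
lemma two_mul_setIntegral_snd_pos {f : ℝ × ℝ → ℝ} (hf : Integrable f)
    (heven : ∀ x y, f (x, -y) = f (x, y)) :
    2 * ∫ z in {z : ℝ × ℝ | 0 < z.2}, f z = ∫ z, f z := by
  have hmp : MeasurePreserving (Prod.map id Neg.neg : ℝ × ℝ → ℝ × ℝ) :=
    (MeasurePreserving.id volume).prod (Measure.measurePreserving_neg volume)
  have hemb : MeasurableEmbedding (Prod.map id Neg.neg : ℝ × ℝ → ℝ × ℝ) :=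
    ((MeasurableEquiv.refl ℝ).prodCongr (MeasurableEquiv.neg ℝ)).measurableEmbedding
  have hms : MeasurableSet {z : ℝ × ℝ | 0 < z.2} := measurableSet_lt measurable_const measurable_snd
  have h1 := hmp.setIntegral_preimage_emb hemb f {z : ℝ × ℝ | 0 < z.2}
  have h2 : ∫ z in {z : ℝ × ℝ | 0 < z.2}ᶜ, f z =
      ∫ z in (Prod.map id Neg.neg : ℝ × ℝ → ℝ × ℝ) ⁻¹' {z : ℝ × ℝ | 0 < z.2}, f z := by
    refine setIntegral_congr_set ?_
    filter_upwards [volume_snd_eq 0] with z hz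
    apply propext
    change ¬ (0 < z.2) ↔ 0 < -z.2
    rw [not_lt, neg_pos]
    exact ⟨fun h => lt_of_le_of_ne h hz, le_of_lt⟩
  have h3 : ∀ z : ℝ × ℝ, f (Prod.map id Neg.neg z) = f z := fun z => heven z.1 z.2
  simp only [h3] at h1
  rw [← integral_add_compl hms hf, h2, h1, two_mul]

lemma equivRealProd_symm_eq (z : ℝ × ℝ) : measurableEquivRealProd.symm z = z.1 + z.2 * I := by
  rw [← mk_eq_add_mul_I]; rfl

/-- The inclusion `(x, y) ↦ x + i y` as a real-linear map. -/
noncomputable def toComplex : ℝ × ℝ →L[ℝ] ℂ := equivRealProdCLM.symm.toContinuousLinearMap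

lemma toComplex_apply (z : ℝ × ℝ) : toComplex z = z.1 + z.2 * I := by
  rw [← mk_eq_add_mul_I]; rfl

lemma fderiv_shoikhetAngle_right {w : ℂ} {z : ℝ × ℝ} (h1 : z.2 ≠ w.im) (h2 : z.2 ≠ -w.im)
    (u : ℝ × ℝ) :
    fderiv ℝ (fun z : ℝ × ℝ => shoikhetAngle w (z.1 + z.2 * I)) z u =
      (((toComplex z - w)⁻¹ - (toComplex z - conj w)⁻¹) * toComplex u).im := by
  have key : ∀ a : ℂ, z.2 ≠ a.im → HasFDerivAt (fun z => (a - toComplex z).arg)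
      (imCLM.comp ((a - toComplex z)⁻¹ • -toComplex)) z := fun a ha =>
    hasFDerivAt_arg (toComplex.hasFDerivAt.const_sub a)
      (by simpa [toComplex_apply, sub_eq_zero] using ha.symm)
  have h := (((key w h1).sub (key (conj w) (by simpa using h2))).sub_const
    (w - I).arg).add_const (conj w - I).arg
  have e : ∀ a : ℂ, (toComplex z - a)⁻¹ = -(a - toComplex z)⁻¹ := fun a => by
    rw [← inv_neg, neg_sub]
  simp only [← toComplex_apply, shoikhetAngle]
  refine (congrArg (fun L => L u) h.fderiv).trans ?_
  simp only [sub_apply, ContinuousLinearMap.comp_apply, imCLM_apply,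
    smul_apply, neg_apply, smul_eq_mul, e]
  rw [← sub_im]
  congr 1
  ring

lemma fderiv_shoikhetAngle_left {v : ℂ} {z : ℝ × ℝ} (h1 : z.2 ≠ v.im) (h2 : z.2 ≠ -v.im)
    (h3 : z.2 ≠ 1) (h4 : z.2 ≠ -1) (u : ℝ × ℝ) :
    fderiv ℝ (fun z : ℝ × ℝ => shoikhetAngle (z.1 + z.2 * I) v) z u =
      (((toComplex z - v)⁻¹ + (toComplex z - conj v)⁻¹ - (toComplex z - I)⁻¹
        - (toComplex z - conj I)⁻¹) * toComplex u).im := by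
  have key : ∀ a : ℂ, z.2 ≠ a.im → HasFDerivAt (fun z => (toComplex z - a).arg)
      (imCLM.comp ((toComplex z - a)⁻¹ • toComplex)) z := fun a ha =>
    hasFDerivAt_arg (toComplex.hasFDerivAt.sub_const a)
      (by simpa [toComplex_apply, sub_eq_zero] using ha)
  have key' : ∀ a : ℂ, z.2 ≠ -a.im → HasFDerivAt (fun z => (conj (toComplex z) - a).arg)
      (imCLM.comp ((conj (toComplex z) - a)⁻¹ •
        ((conjCLE : ℂ →L[ℝ] ℂ).comp toComplex))) z := fun a ha =>
    hasFDerivAt_arg (((conjCLE : ℂ →L[ℝ] ℂ).comp toComplex).hasFDerivAt.sub_const a)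
      (by
        intro h
        apply ha
        simp [toComplex_apply] at h
        linarith)
  have h := (((key v h1).sub (key' v h2)).sub (key I (by simpa using h3))).add
    (key' I (by simpa using h4))
  have e : ∀ a : ℂ, (conj (toComplex z) - a)⁻¹ = conj ((toComplex z - conj a)⁻¹) := fun a => by
    rw [map_inv₀, map_sub, conj_conj]
  have e2 : ∀ p : ℂ, (conj p * conj (toComplex u)).im = -(p * toComplex u).im := fun p => by
    rw [← map_mul, conj_im]
  simp only [← toComplex_apply, shoikhetAngle]
  refine (congrArg (fun L => L u) h.fderiv).trans ?_
  simp only [sub_apply, add_apply,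
    ContinuousLinearMap.comp_apply, imCLM_apply, smul_apply, smul_eq_mul, e,
    ContinuousLinearEquiv.coe_coe, conjCLE_apply, e2, sub_mul, add_mul, sub_im, add_im]
  ring

end ShoikhetAngle

open Complex ComplexConjugate ShoikhetAngle in
/-- Fix `w, v` in the open upper half-plane `H⁺`, with `w, v, i`
pairwise distinct.  Let `F(z) = α(w,z)` and `G(z) = α(z,v)`.  Writing `z = x + iy`, the
function `(∂F/∂x)(∂G/∂y) − (∂F/∂y)(∂G/∂x)` is absolutely integrable on `H⁺` with respect
to Lebesgue measure and its integral vanishes: `∫_{H⁺} dα(w,z) ∧ dα(z,v) = 0`. -/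
theorem integral_dAlpha_wedge_dAlpha_eq_zero (w v : ℂ)
    (hw : 0 < w.im) (hv : 0 < v.im)
    (hwv : w ≠ v) (hwi : w ≠ Complex.I) (hvi : v ≠ Complex.I) :
    let F : ℝ × ℝ → ℝ := fun z => shoikhetAngle w (z.1 + z.2 * Complex.I)
    let G : ℝ × ℝ → ℝ := fun z => shoikhetAngle (z.1 + z.2 * Complex.I) v
    let J : ℝ × ℝ → ℝ := fun z =>
      fderiv ℝ F z (1, 0) * fderiv ℝ G z (0, 1) - fderiv ℝ F z (0, 1) * fderiv ℝ G z (1, 0)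
    IntegrableOn J {z : ℝ × ℝ | 0 < z.2} ∧
      ∫ z in {z : ℝ × ℝ | 0 < z.2}, J z = 0 := by
  intro F G J
  have hJ : J =ᵐ[volume] fun z => wedge w v (measurableEquivRealProd.symm z) := by
    filter_upwards [volume_snd_eq w.im, volume_snd_eq (-w.im), volume_snd_eq v.im,
      volume_snd_eq (-v.im), volume_snd_eq 1, volume_snd_eq (-1)] with z h1 h2 h3 h4 h5 h6
    simp only [J, F, G, fderiv_shoikhetAngle_right h1 h2, fderiv_shoikhetAngle_left h3 h4 h5 h6]
    simp only [wedge, equivRealProd_symm_eq, ← toComplex_apply]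
    have e1 : toComplex (1, 0) = 1 := by simp [toComplex_apply]
    have e2 : toComplex (0, 1) = I := by simp [toComplex_apply]
    rw [e1, e2, mul_one, mul_one, mul_I_im, mul_I_im, mul_im, conj_re, conj_im]
    ring
  have hmp := volume_preserving_equiv_real_prod.symm
  have hint : Integrable (fun z => wedge w v (measurableEquivRealProd.symm z)) :=
    (hmp.integrable_comp_emb measurableEquivRealProd.symm.measurableEmbedding).2
      (integrable_wedge w v)
  refine ⟨(hint.congr hJ.symm).integrableOn, ?_⟩
  rw [integral_congr_ae (ae_restrict_of_ae hJ)]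
  have h := two_mul_setIntegral_snd_pos hint fun x y => by
    rw [← wedge_conj]
    congr 1
    simp only [equivRealProd_symm_eq]
    simp
  rw [hmp.integral_comp measurableEquivRealProd.symm.measurableEmbedding, integral_wedge] at h
  linarith
end

section
/- Fix v ∈ H⁺ with v ≠ i. Let F(z) = β(z) and G(z) = α(z,v), which are smooth real-valued functions of z on H⁺ ∖ {v, i}. Writing z = x + iy, the function (∂F/∂x)(∂G/∂y) − (∂F/∂y)(∂G/∂x) is absolutely integrable on H⁺ with respect to Lebesgue measure, and ∫_{H⁺} ((∂F/∂x)(∂G/∂y) − (∂F/∂y)(∂G/∂x)) dx dy = 0; i.e. ∫_{H⁺} dβ(z) ∧ dα(z,v) = 0. -/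
open MeasureTheory

/-- The second Shoikhet angle function `β(q) = Arg(i−q) − Arg(−i−q)`. -/
noncomputable def shoikhetBeta (q : ℂ) : ℝ :=
  (Complex.I - q).arg - (-Complex.I - q).arg

open ComplexConjugate

namespace Shoikhet

lemma hasFDerivAt_arg_comp {γ : ℝ × ℝ → ℂ} {γ' : ℝ × ℝ →L[ℝ] ℂ} {z : ℝ × ℝ}
    (hγ : HasFDerivAt γ γ' z) (h : γ z ∈ Complex.slitPlane) :
    HasFDerivAt (fun x => (γ x).arg) (Complex.imCLM ∘L ((γ z)⁻¹ • γ')) z := by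
  have h1 := (Complex.hasStrictFDerivAt_log_real h).hasFDerivAt.comp z hγ
  have h2 := Complex.imCLM.hasFDerivAt.comp z h1
  have e : Complex.imCLM ∘L ((γ z)⁻¹ • γ')
      = Complex.imCLM ∘L (((γ z)⁻¹ • (1 : ℂ →L[ℝ] ℂ)) ∘L γ') :=
    ContinuousLinearMap.ext fun x => by simp
  rw [e]
  simpa only [Function.comp_def, Complex.imCLM_apply, Complex.log_im] using h2

/-- The map `(x, y) ↦ x + y i` as a real linear map. -/
noncomputable def toComplexCLM : ℝ × ℝ →L[ℝ] ℂ :=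
  Complex.equivRealProdCLM.symm.toContinuousLinearMap

lemma toComplexCLM_apply (z : ℝ × ℝ) : toComplexCLM z = z.1 + z.2 * Complex.I := by
  simp [toComplexCLM, Complex.equivRealProdCLM_symm_apply]

lemma hasFDerivAt_toComplex (z : ℝ × ℝ) :
    HasFDerivAt (fun x : ℝ × ℝ => (x.1 + x.2 * Complex.I : ℂ)) toComplexCLM z := by
  have h := toComplexCLM.hasFDerivAt (x := z)
  convert h using 1
  ext x
  rw [toComplexCLM_apply]

lemma hasFDerivAt_conj_toComplex (z : ℝ × ℝ) :
    HasFDerivAt (fun x : ℝ × ℝ => conj (x.1 + x.2 * Complex.I : ℂ))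
      (Complex.conjCLE.toContinuousLinearMap ∘L toComplexCLM) z :=
  Complex.conjCLE.toContinuousLinearMap.hasFDerivAt.comp z (hasFDerivAt_toComplex z)

/-- The holomorphic function whose imaginary part of `betaDeriv z dz` is `dβ`. -/
noncomputable def betaDeriv (z : ℂ) : ℂ := (z - Complex.I)⁻¹ - (z + Complex.I)⁻¹

/-- The holomorphic function whose imaginary part of `angleDeriv v z dz` is `dα(·, v)`. -/
noncomputable def angleDeriv (v z : ℂ) : ℂ :=
  (z - v)⁻¹ + (z - conj v)⁻¹ - (z - Complex.I)⁻¹ - (z + Complex.I)⁻¹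

/-- The density of `dβ ∧ dα(·, v)` with respect to Lebesgue measure. -/
noncomputable def wedgeDensity (v z : ℂ) : ℝ := (betaDeriv z * conj (angleDeriv v z)).im

lemma fderiv_shoikhetBeta {z : ℝ × ℝ} (hz : 0 < z.2) (h1 : z.2 ≠ 1) (e : ℝ × ℝ) :
    fderiv ℝ (fun z : ℝ × ℝ => shoikhetBeta (z.1 + z.2 * Complex.I)) z e
      = (betaDeriv (z.1 + z.2 * Complex.I) * (e.1 + e.2 * Complex.I)).im := by
  have d1 := hasFDerivAt_arg_comp ((hasFDerivAt_toComplex z).const_sub Complex.I)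
    (Or.inr (by simpa [sub_eq_zero] using h1.symm))
  have d2 := hasFDerivAt_arg_comp ((hasFDerivAt_toComplex z).const_sub (-Complex.I))
    (Or.inr (by simp; linarith))
  unfold shoikhetBeta
  rw [(d1.fun_sub d2).fderiv]
  simp only [sub_apply, ContinuousLinearMap.comp_apply,
    smul_apply, neg_apply, toComplexCLM_apply,
    Complex.imCLM_apply, smul_eq_mul, betaDeriv, ← Complex.sub_im]
  congr 1
  rw [← neg_sub (_ : ℂ) Complex.I, ← neg_add', add_comm Complex.I, inv_neg, inv_neg]
  ring

lemma fderiv_shoikhetAngle {v : ℂ} (hv : 0 < v.im) {z : ℝ × ℝ} (hz : 0 < z.2) (h1 : z.2 ≠ 1)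
    (h2 : z.2 ≠ v.im) (e : ℝ × ℝ) :
    fderiv ℝ (fun z : ℝ × ℝ => shoikhetAngle (z.1 + z.2 * Complex.I) v) z e
      = (angleDeriv v (z.1 + z.2 * Complex.I) * (e.1 + e.2 * Complex.I)).im := by
  have d1 := hasFDerivAt_arg_comp ((hasFDerivAt_toComplex z).sub_const v)
    (Or.inr (by simpa [sub_eq_zero] using h2))
  have d2 := hasFDerivAt_arg_comp ((hasFDerivAt_conj_toComplex z).sub_const v)
    (Or.inr (by simp; linarith))
  have d3 := hasFDerivAt_arg_comp ((hasFDerivAt_toComplex z).sub_const Complex.I)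
    (Or.inr (by simpa [sub_eq_zero] using h1))
  have d4 := hasFDerivAt_arg_comp ((hasFDerivAt_conj_toComplex z).sub_const Complex.I)
    (Or.inr (by simp; linarith))
  unfold shoikhetAngle
  rw [(((d1.fun_sub d2).fun_sub d3).fun_add d4).fderiv]
  have key (a w ε : ℂ) : ((conj w - a)⁻¹ * conj ε).im = - ((w - conj a)⁻¹ * ε).im := by
    rw [← Complex.conj_im]
    simp
  simp only [sub_apply, add_apply,
    ContinuousLinearMap.comp_apply, ContinuousLinearEquiv.coe_coe, Complex.conjCLE_apply,
    smul_apply, toComplexCLM_apply,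
    Complex.imCLM_apply, smul_eq_mul, angleDeriv, key, Complex.conj_I, sub_neg_eq_add]
  simp only [sub_mul, add_mul, Complex.sub_im, Complex.add_im]
  ring

lemma fderiv_wedge_eq_wedgeDensity {v : ℂ} (hv : 0 < v.im) {z : ℝ × ℝ} (hz : 0 < z.2)
    (h1 : z.2 ≠ 1) (h2 : z.2 ≠ v.im) :
    fderiv ℝ (fun z : ℝ × ℝ => shoikhetBeta (z.1 + z.2 * Complex.I)) z (1, 0) *
        fderiv ℝ (fun z : ℝ × ℝ => shoikhetAngle (z.1 + z.2 * Complex.I) v) z (0, 1) -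
      fderiv ℝ (fun z : ℝ × ℝ => shoikhetBeta (z.1 + z.2 * Complex.I)) z (0, 1) *
        fderiv ℝ (fun z : ℝ × ℝ => shoikhetAngle (z.1 + z.2 * Complex.I) v) z (1, 0)
      = wedgeDensity v (z.1 + z.2 * Complex.I) := by
  simp only [fderiv_shoikhetBeta hz h1, fderiv_shoikhetAngle hv hz h1 h2, wedgeDensity]
  simp
  ring

/-- The Cayley transform from the unit disc to the upper half-plane. -/
noncomputable def cayley (w : ℂ) : ℂ := Complex.I * (1 + w) / (1 - w)

/-- The pullback of `wedgeDensity` to the unit disc, where `u` corresponds to `v`. -/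
noncomputable def discDensity (u w : ℂ) : ℝ :=
  (w⁻¹ * conj ((w - u)⁻¹ - conj u / (1 - conj u * w) - w⁻¹)).im

lemma one_sub_ne_zero_of_mem_ball {w : ℂ} (hw : w ∈ Metric.ball (0 : ℂ) 1) : 1 - w ≠ 0 := by
  intro h
  rw [← sub_eq_zero.mp h] at hw
  simp at hw

lemma cayley_im (w : ℂ) : (cayley w).im = (1 - ‖w‖ ^ 2) / ‖1 - w‖ ^ 2 := by
  rw [cayley, Complex.div_im, ← Complex.normSq_eq_norm_sq, ← Complex.normSq_eq_norm_sq,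
    ← sub_div]
  congr 1
  simp [Complex.normSq_apply]
  ring

lemma cayley_sub {w u : ℂ} (hw : 1 - w ≠ 0) (hu : 1 - u ≠ 0) :
    cayley w - cayley u = 2 * Complex.I * (w - u) / ((1 - w) * (1 - u)) := by
  unfold cayley
  field_simp
  ring

lemma cayley_sub_conj {w u : ℂ} (hw : 1 - w ≠ 0) (hu : 1 - conj u ≠ 0) :
    cayley w - conj (cayley u)
      = 2 * Complex.I * (1 - conj u * w) / ((1 - w) * (1 - conj u)) := by
  simp only [cayley, map_div₀, map_mul, map_sub, map_add, map_one, Complex.conj_I]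
  field_simp
  ring

lemma cayley_zero : cayley 0 = Complex.I := by simp [cayley]

lemma cayley_injOn : Set.InjOn cayley (Metric.ball 0 1) := by
  intro w hw u hu h
  have hw := one_sub_ne_zero_of_mem_ball hw
  have hu := one_sub_ne_zero_of_mem_ball hu
  have := cayley_sub hw hu
  rw [h, sub_self, eq_comm, div_eq_zero_iff] at this
  simpa [hw, hu, sub_eq_zero] using this

lemma cayley_image : cayley '' Metric.ball 0 1 = {z : ℂ | 0 < z.im} := by
  ext z
  constructor
  · rintro ⟨w, hw, rfl⟩
    have h1 := norm_pos_iff.mpr (one_sub_ne_zero_of_mem_ball hw)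
    have hw : ‖w‖ < 1 := by simpa using hw
    rw [Set.mem_ofPred_eq, cayley_im]
    have : 0 < 1 - ‖w‖ ^ 2 := by nlinarith [norm_nonneg w]
    positivity
  · intro hz
    have hz : 0 < z.im := hz
    have hne : z + Complex.I ≠ 0 := by
      intro h
      have := congrArg Complex.im h
      simp at this
      linarith
    refine ⟨(z - Complex.I) / (z + Complex.I), ?_, ?_⟩
    · rw [mem_ball_zero_iff, norm_div, div_lt_one (norm_pos_iff.mpr hne),
        ← sq_lt_sq₀ (norm_nonneg _) (norm_nonneg _), ← Complex.normSq_eq_norm_sq,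
        ← Complex.normSq_eq_norm_sq]
      simp [Complex.normSq_apply]
      nlinarith
    · have : z + Complex.I - (z - Complex.I) ≠ 0 := by
        ring_nf
        simp
      unfold cayley
      field_simp
      ring

/-- The derivative of the Cayley transform. -/
noncomputable def cayleyDeriv (w : ℂ) : ℂ := 2 * Complex.I / (1 - w) ^ 2

lemma hasDerivAt_cayley {w : ℂ} (hw : 1 - w ≠ 0) :
    HasDerivAt cayley (cayleyDeriv w) w := by
  have h1 : HasDerivAt (fun w : ℂ => Complex.I * (1 + w)) (Complex.I * 1) w :=
    ((hasDerivAt_id w).const_add 1).const_mul _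
  have h2 : HasDerivAt (fun w : ℂ => 1 - w) (-1) w := (hasDerivAt_id w).const_sub 1
  refine (h1.fun_div h2 hw).congr_deriv ?_
  rw [cayleyDeriv]
  congr 1
  ring

/-- The derivative of the Cayley transform as a real linear map. -/
noncomputable def cayleyFDeriv (w : ℂ) : ℂ →L[ℝ] ℂ :=
  (ContinuousLinearMap.toSpanSingleton ℂ (cayleyDeriv w)).restrictScalars ℝ

lemma hasFDerivAt_cayley {w : ℂ} (hw : 1 - w ≠ 0) :
    HasFDerivAt cayley (cayleyFDeriv w) w :=
  (hasDerivAt_cayley hw).hasFDerivAt.restrictScalars ℝ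

lemma abs_det_cayleyFDeriv (w : ℂ) : |(cayleyFDeriv w).det| = ‖cayleyDeriv w‖ ^ 2 := by
  have : (cayleyFDeriv w).det = ‖cayleyDeriv w‖ ^ 2 := by
    simp [cayleyFDeriv, ContinuousLinearMap.det, LinearMap.det_restrictScalars,
      Algebra.norm_complex_eq, Complex.normSq_eq_norm_sq]
  rw [this, abs_of_nonneg (by positivity)]

lemma one_sub_conj_mul_ne_zero {u w : ℂ} (hu : u ∈ Metric.ball (0 : ℂ) 1)
    (hw : w ∈ Metric.ball (0 : ℂ) 1) : 1 - conj u * w ≠ 0 := by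
  apply one_sub_ne_zero_of_mem_ball
  rw [mem_ball_zero_iff] at *
  rw [norm_mul, Complex.norm_conj]
  nlinarith [norm_nonneg w, norm_nonneg u]

lemma cayleyDeriv_mul_inv_cayley_sub {u w : ℂ} (hu : 1 - u ≠ 0) (hw : 1 - w ≠ 0) (h : w ≠ u) :
    cayleyDeriv w * (cayley w - cayley u)⁻¹ = (w - u)⁻¹ + (1 - w)⁻¹ := by
  have := sub_ne_zero.mpr h
  rw [cayley_sub hw hu, cayleyDeriv]
  have := Complex.I_ne_zero
  field_simp
  ring

lemma cayleyDeriv_mul_inv_cayley_sub_conj {u w : ℂ} (hu : 1 - conj u ≠ 0) (hw : 1 - w ≠ 0)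
    (h : 1 - conj u * w ≠ 0) :
    cayleyDeriv w * (cayley w - conj (cayley u))⁻¹
      = (1 - w)⁻¹ - conj u / (1 - conj u * w) := by
  rw [cayley_sub_conj hw hu, cayleyDeriv]
  generalize conj u = c at *
  rw [mul_comm] at h
  rw [mul_comm c w]
  have := Complex.I_ne_zero
  field_simp
  ring

lemma det_smul_wedgeDensity_cayley {u w : ℂ} (hu : u ∈ Metric.ball (0 : ℂ) 1)
    (hw : w ∈ Metric.ball (0 : ℂ) 1) (h0 : w ≠ 0) (h : w ≠ u) :
    |(cayleyFDeriv w).det| • wedgeDensity (cayley u) (cayley w) = discDensity u w := by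
  have hw1 := one_sub_ne_zero_of_mem_ball hw
  have hu1 := one_sub_ne_zero_of_mem_ball hu
  have hu2 : 1 - conj u ≠ 0 := by
    simpa using (map_ne_zero (starRingEnd ℂ)).mpr hu1
  have e1 := cayleyDeriv_mul_inv_cayley_sub hu1 hw1 h
  have e2 := cayleyDeriv_mul_inv_cayley_sub_conj hu2 hw1 (one_sub_conj_mul_ne_zero hu hw)
  have e3 := cayleyDeriv_mul_inv_cayley_sub (u := 0) (by simp) hw1 h0
  have e4 := cayleyDeriv_mul_inv_cayley_sub_conj (u := 0) (by simp) hw1 (by simp)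
  rw [cayley_zero] at e3 e4
  simp only [Complex.conj_I, sub_neg_eq_add, map_zero, zero_div, sub_zero] at e3 e4
  have hb : cayleyDeriv w * betaDeriv (cayley w) = w⁻¹ := by
    rw [betaDeriv, mul_sub, e3, e4]
    ring
  have ha : cayleyDeriv w * angleDeriv (cayley u) (cayley w)
      = (w - u)⁻¹ - conj u / (1 - conj u * w) - w⁻¹ := by
    rw [angleDeriv, mul_sub, mul_sub, mul_add, e1, e2, e3, e4]
    ring
  rw [discDensity, ← ha, ← hb, abs_det_cayleyFDeriv, wedgeDensity, smul_eq_mul,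
    ← Complex.im_ofReal_mul, map_mul]
  congr 1
  push_cast
  rw [← Complex.mul_conj']
  ring

lemma integrableOn_inv_norm_ball (r : ℝ) :
    IntegrableOn (fun w : ℂ => ‖w‖⁻¹) (Metric.ball 0 r) := by
  refine integrableOn_ball_of_norm_le_rpow (α := 1) (C := 1) (by simp) (by simp) ?_ ?_
  · filter_upwards with w
    simp [Real.rpow_neg_one]
  · exact (measurable_norm.inv).aestronglyMeasurable

lemma integrableOn_inv_norm_sub_ball {u : ℂ} (hu : u ∈ Metric.ball (0 : ℂ) 1) :
    IntegrableOn (fun w : ℂ => ‖w - u‖⁻¹) (Metric.ball 0 1) := by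
  have h := (measurePreserving_sub_right (volume : Measure ℂ) u).integrableOn_comp_preimage
    (MeasurableEquiv.subRight u).measurableEmbedding |>.mpr (integrableOn_inv_norm_ball 2)
  refine IntegrableOn.mono_set h fun w hw => ?_
  rw [Set.mem_preimage, mem_ball_zero_iff]
  rw [mem_ball_zero_iff] at hu hw
  linarith [norm_sub_le w u]

lemma measurable_discDensity (u : ℂ) : Measurable (discDensity u) := by
  unfold discDensity
  refine Complex.measurable_im.comp (Measurable.mul (by fun_prop) ?_)
  refine (Complex.continuous_conj.measurable).comp ?_
  fun_prop

lemma norm_discDensity_le {u w : ℂ} (hu : u ∈ Metric.ball (0 : ℂ) 1) (hu0 : u ≠ 0)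
    (hw : w ∈ Metric.ball (0 : ℂ) 1) (h0 : w ≠ 0) (h : w ≠ u) :
    ‖discDensity u w‖ ≤ ‖u‖⁻¹ * (‖w‖⁻¹ + ‖w - u‖⁻¹) + ‖u‖ / (1 - ‖u‖) * ‖w‖⁻¹ := by
  have e : discDensity u w
      = (w⁻¹ * conj ((w - u)⁻¹ - conj u / (1 - conj u * w))).im := by
    have : (w⁻¹ * conj w⁻¹).im = 0 := by
      rw [Complex.mul_conj]
      simp
    rw [discDensity, map_sub, mul_sub, Complex.sub_im, this, sub_zero]
  have hwp := norm_pos_iff.mpr h0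
  have hup := norm_pos_iff.mpr hu0
  have hsp := norm_pos_iff.mpr (sub_ne_zero.mpr h)
  rw [mem_ball_zero_iff] at hu hw
  have hd : 1 - ‖u‖ ≤ ‖1 - conj u * w‖ := by
    have := norm_sub_norm_le 1 (conj u * w)
    rw [norm_one, norm_mul, Complex.norm_conj] at this
    nlinarith
  have h1 : ‖w‖⁻¹ * ‖w - u‖⁻¹ ≤ ‖u‖⁻¹ * (‖w‖⁻¹ + ‖w - u‖⁻¹) := by
    have : ‖u‖ ≤ ‖w‖ + ‖w - u‖ := by
      have := norm_sub_le w (w - u)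
      rwa [sub_sub_cancel] at this
    field_simp
    linarith
  have h2 : ‖conj u / (1 - conj u * w)‖ ≤ ‖u‖ / (1 - ‖u‖) := by
    rw [norm_div, Complex.norm_conj]
    have : 0 < 1 - ‖u‖ := by linarith
    gcongr
  rw [e, Real.norm_eq_abs]
  refine (Complex.abs_im_le_norm _).trans ?_
  rw [norm_mul, Complex.norm_conj, norm_inv]
  calc ‖w‖⁻¹ * ‖(w - u)⁻¹ - conj u / (1 - conj u * w)‖
      ≤ ‖w‖⁻¹ * (‖w - u‖⁻¹ + ‖u‖ / (1 - ‖u‖)) := by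
        gcongr
        refine (norm_sub_le _ _).trans ?_
        rw [norm_inv]
        gcongr
    _ ≤ _ := by
        rw [mul_add, mul_comm (‖u‖ / _)]
        gcongr

lemma ae_ball_ne (u : ℂ) : ∀ᵐ w ∂(volume.restrict (Metric.ball (0 : ℂ) 1)),
    w ∈ Metric.ball (0 : ℂ) 1 ∧ w ≠ 0 ∧ w ≠ u := by
  filter_upwards [ae_restrict_mem measurableSet_ball, Measure.ae_ne _ 0, Measure.ae_ne _ u]
    with w h1 h2 h3 using ⟨h1, h2, h3⟩

lemma integrableOn_discDensity {u : ℂ} (hu : u ∈ Metric.ball (0 : ℂ) 1) (hu0 : u ≠ 0) :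
    IntegrableOn (discDensity u) (Metric.ball 0 1) := by
  have h1 := integrableOn_inv_norm_ball 1
  have h2 := integrableOn_inv_norm_sub_ball hu
  refine Integrable.mono' (((h1.add h2).const_mul ‖u‖⁻¹).add (h1.const_mul (‖u‖ / (1 - ‖u‖))))
    (measurable_discDensity u).aestronglyMeasurable ?_
  filter_upwards [ae_ball_ne u] with w hw
  exact norm_discDensity_le hu hu0 hw.1 hw.2.1 hw.2.2

/-- Reflection of the plane in the line through `0` and `u`. -/
noncomputable def reflectionThrough {u : ℂ} (hu : u ≠ 0) : ℂ ≃ₗᵢ[ℝ] ℂ :=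
  Complex.conjLIE.trans (rotation (Circle.ofConjDivSelf (conj u)
    ((map_ne_zero (starRingEnd ℂ)).mpr hu)))

lemma reflectionThrough_apply {u : ℂ} (hu : u ≠ 0) (w : ℂ) :
    reflectionThrough hu w = u / conj u * conj w := by
  change rotation _ (conj w) = _
  rw [rotation_apply]
  simp [Circle.ofConjDivSelf]

lemma discDensity_reflectionThrough {u : ℂ} (hu : u ≠ 0) (w : ℂ) :
    discDensity u (reflectionThrough hu w) = - discDensity u w := by
  have hu' : conj u ≠ 0 := (map_ne_zero (starRingEnd ℂ)).mpr hu
  have e1 : (u / conj u * conj w - u)⁻¹ = conj u / u * conj (w - u)⁻¹ := by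
    rw [map_inv₀, map_sub, ← inv_div u, ← mul_inv]
    congr 1
    field_simp
  have e2 : conj u / (1 - conj u * (u / conj u * conj w))
      = conj u / u * conj (conj u / (1 - conj u * w)) := by
    have : conj u * (u / conj u * conj w) = u * conj w := by field_simp
    rw [this]
    simp only [map_div₀, map_sub, map_mul, map_one, Complex.conj_conj]
    field_simp
  have e3 : (u / conj u * conj w)⁻¹ = conj u / u * conj w⁻¹ := by
    rw [mul_inv, inv_div, map_inv₀]
  rw [discDensity, discDensity, reflectionThrough_apply, e1, e2, e3, ← mul_sub, ← mul_sub,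
    ← map_sub, ← map_sub, ← Complex.conj_im]
  congr 1
  simp only [map_mul, map_div₀, Complex.conj_conj]
  field_simp

lemma integral_discDensity {u : ℂ} (hu : u ≠ 0) :
    ∫ w in Metric.ball (0 : ℂ) 1, discDensity u w = 0 := by
  have h := (reflectionThrough hu).measurePreserving.setIntegral_preimage_emb
    (reflectionThrough hu).toMeasurableEquiv.measurableEmbedding (discDensity u)
    (Metric.ball 0 1)
  have hs : reflectionThrough hu ⁻¹' Metric.ball 0 1 = Metric.ball 0 1 := by
    ext w
    simp
  simp only [hs, discDensity_reflectionThrough, integral_neg] at h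
  linarith

lemma wedgeDensity_integrable_and_integral {v : ℂ} (hv : 0 < v.im) (hvi : v ≠ Complex.I) :
    IntegrableOn (wedgeDensity v) {z : ℂ | 0 < z.im} ∧
      ∫ z in {z : ℂ | 0 < z.im}, wedgeDensity v z = 0 := by
  obtain ⟨u, hu, rfl⟩ : v ∈ cayley '' Metric.ball 0 1 := by
    rw [cayley_image]
    exact hv
  have hu0 : u ≠ 0 := by
    rintro rfl
    exact hvi cayley_zero
  have hd : ∀ w ∈ Metric.ball (0 : ℂ) 1,
      HasFDerivWithinAt cayley (cayleyFDeriv w) (Metric.ball 0 1) w := fun w hw =>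
    (hasFDerivAt_cayley (one_sub_ne_zero_of_mem_ball hw)).hasFDerivWithinAt
  have hae : (fun w => |(cayleyFDeriv w).det| • wedgeDensity (cayley u) (cayley w))
      =ᵐ[volume.restrict (Metric.ball 0 1)] discDensity u := by
    filter_upwards [ae_ball_ne u] with w hw
    exact det_smul_wedgeDensity_cayley hu hw.1 hw.2.1 hw.2.2
  rw [← cayley_image,
    integrableOn_image_iff_integrableOn_abs_det_fderiv_smul _ measurableSet_ball hd cayley_injOn,
    integral_image_eq_integral_abs_det_fderiv_smul _ measurableSet_ball hd cayley_injOn]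
  exact ⟨(integrableOn_discDensity hu hu0).congr hae.symm,
    (integral_congr_ae hae).trans (integral_discDensity hu0)⟩

lemma ae_snd_ne (c : ℝ) : ∀ᵐ z : ℝ × ℝ, z.2 ≠ c :=
  Measure.quasiMeasurePreserving_snd.ae (Measure.ae_ne _ c)

end Shoikhet

/-- Fix `v` in the open upper half-plane `H⁺` with `v ≠ i`.  Let
`F(z) = β(z)` and `G(z) = α(z,v)`.  Writing `z = x + iy`, the function
`(∂F/∂x)(∂G/∂y) − (∂F/∂y)(∂G/∂x)` is absolutely integrable on `H⁺` with respect to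
Lebesgue measure and its integral vanishes: `∫_{H⁺} dβ(z) ∧ dα(z,v) = 0`. -/
theorem integral_dBeta_wedge_dAlpha_eq_zero (v : ℂ)
    (hv : 0 < v.im) (hvi : v ≠ Complex.I) :
    let F : ℝ × ℝ → ℝ := fun z => shoikhetBeta (z.1 + z.2 * Complex.I)
    let G : ℝ × ℝ → ℝ := fun z => shoikhetAngle (z.1 + z.2 * Complex.I) v
    let J : ℝ × ℝ → ℝ := fun z =>
      fderiv ℝ F z (1, 0) * fderiv ℝ G z (0, 1) - fderiv ℝ F z (0, 1) * fderiv ℝ G z (1, 0)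
    IntegrableOn J {z : ℝ × ℝ | 0 < z.2} ∧
      ∫ z in {z : ℝ × ℝ | 0 < z.2}, J z = 0 := by
  intro F G J
  obtain ⟨hintegrable, hzero⟩ := Shoikhet.wedgeDensity_integrable_and_integral hv hvi
  have hmp := Complex.volume_preserving_equiv_real_prod.symm
  have hemb := Complex.measurableEquivRealProd.symm.measurableEmbedding
  have happ (z : ℝ × ℝ) : Complex.measurableEquivRealProd.symm z = z.1 + z.2 * Complex.I := by
    rw [Complex.measurableEquivRealProd_symm_apply, Complex.mk_eq_add_mul_I]
  have hpre : Complex.measurableEquivRealProd.symm ⁻¹' {z : ℂ | 0 < z.im}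
      = {z : ℝ × ℝ | 0 < z.2} := by
    ext z
    simp [Complex.measurableEquivRealProd_symm_apply]
  have hmeas : MeasurableSet {z : ℝ × ℝ | 0 < z.2} :=
    measurableSet_lt measurable_const measurable_snd
  have hae : J =ᵐ[volume.restrict {z : ℝ × ℝ | 0 < z.2}]
      fun z => Shoikhet.wedgeDensity v (Complex.measurableEquivRealProd.symm z) := by
    filter_upwards [ae_restrict_mem hmeas, ae_restrict_of_ae (Shoikhet.ae_snd_ne 1),
      ae_restrict_of_ae (Shoikhet.ae_snd_ne v.im)] with z hz h1 h2
    rw [happ]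
    exact Shoikhet.fderiv_wedge_eq_wedgeDensity hv hz h1 h2
  have hintegrable' := (hmp.integrableOn_comp_preimage hemb).mpr hintegrable
  have hzero' := (hmp.setIntegral_preimage_emb hemb (Shoikhet.wedgeDensity v) _).trans hzero
  rw [hpre] at hintegrable' hzero'
  exact ⟨Integrable.congr hintegrable' hae.symm, (integral_congr_ae hae).trans hzero'⟩
end
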